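/- Let q0 be a nonzero complex number. If the reduced Burau representation of B_3 specialized at q0 is not faithful (i.e., the group homomorphism B_3 → GL(2, ℂ) determined by σ1 ↦ [[-q0, q0], [0, 1]] and σ2 ↦ [[1, 0], [1, -q0]] is not injective), then both q0 and 1/q0 are roots of a monic polynomial with integer coefficients; in particular both q0 and 1/q0 are algebraic integers. -/

import Mathlib

/-- The braid relation for the braid group `B₃` on generators `σ₁ = of 0`, `σ₂ = of 1`:
`σ₁σ₂σ₁ = σ₂σ₁σ₂`. -/
def braidRels3 : Set (FreeGroup (Fin 2)) :=
  {FreeGroup.of 0 * FreeGroup.of 1 * FreeGroup.of 0 *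
    (FreeGroup.of 1 * FreeGroup.of 0 * FreeGroup.of 1)⁻¹}

/-- The braid group `B₃` as a presented group. -/
abbrev BraidGroup3 : Type := PresentedGroup braidRels3

/-- The standard generators `σ₁, σ₂` of `B₃`. -/
def σ₃ (i : Fin 2) : BraidGroup3 := PresentedGroup.of i

open Polynomial in
/-- Shape of the (rescaled) matrix of a positive word in `σ₁, σ₂⁻¹`. -/
def ColOK (x y : Polynomial ℤ) : Prop := x.Monic ∧ y.Monic ∧ y.degree < x.degree

open Polynomial in
lemma ColOK.p {x y : Polynomial ℤ} (h : ColOK x y) : ColOK (X * (x + y)) y := by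
  obtain ⟨hx, hy, hd⟩ := h
  have h1 : (x + y).Monic := hx.add_of_left hd
  refine ⟨monic_X.mul h1, hy, ?_⟩
  rw [degree_mul, degree_X, degree_add_eq_left_of_degree_lt hd]
  refine hd.trans ?_
  rw [degree_eq_natDegree hx.ne_zero]
  norm_cast
  omega

open Polynomial in
lemma deg_lt_X {x : Polynomial ℤ} (hx : x.Monic) : x.degree < (X * x).degree := by
  rw [degree_mul, degree_X, degree_eq_natDegree hx.ne_zero]
  norm_cast
  omega

open Polynomial in
lemma ColOK.q {x y : Polynomial ℤ} (h : ColOK x y) : ColOK (X * x) (x + y) := by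
  obtain ⟨hx, hy, hd⟩ := h
  refine ⟨monic_X.mul hx, hx.add_of_left hd, ?_⟩
  rw [degree_add_eq_left_of_degree_lt hd]
  exact deg_lt_X hx

/-- The shape of a matrix of a positive word; `ne` says that the word is nonempty. -/
def GoodMat (q : ℂ) (ne : Prop) (M : Matrix (Fin 2) (Fin 2) ℂ) : Prop :=
  ∃ (c : ℂ) (x1 y1 x2 y2 : Polynomial ℤ), c ≠ 0 ∧
    ((x1.Monic ∧ y1 = 0) ∨ ColOK x1 y1) ∧ ((x2 = 0 ∧ y2 = 1) ∨ ColOK x2 y2) ∧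
    (ne → ColOK x1 y1 ∨ ColOK x2 y2) ∧
    M = !![c * Polynomial.aeval (-q) x1, -(c * Polynomial.aeval (-q) x2);
      -(c * Polynomial.aeval (-q) y1), c * Polynomial.aeval (-q) y2]

lemma goodMat_one (q : ℂ) : GoodMat q False 1 := by
  refine ⟨1, 1, 0, 0, 1, one_ne_zero, Or.inl ⟨Polynomial.monic_one, rfl⟩, Or.inl ⟨rfl, rfl⟩,
    fun h => h.elim, ?_⟩
  simp [Matrix.one_fin_two]

open Polynomial in
lemma GoodMat.p {q : ℂ} {ne : Prop} {M : Matrix (Fin 2) (Fin 2) ℂ} (h : GoodMat q ne M) :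
    GoodMat q True (!![-q, q; 0, 1] * M) := by
  obtain ⟨c, x1, y1, x2, y2, hc, h1, h2, -, rfl⟩ := h
  have h2' : ColOK (X * (x2 + y2)) y2 := by
    rcases h2 with ⟨rfl, rfl⟩ | h2
    · refine ⟨?_, monic_one, ?_⟩ <;> simp [monic_X]
    · exact h2.p
  refine ⟨c, X * (x1 + y1), y1, X * (x2 + y2), y2, hc, ?_, Or.inr h2', fun _ => Or.inr h2', ?_⟩
  · rcases h1 with ⟨h1, rfl⟩ | h1
    · left
      refine ⟨?_, rfl⟩
      rw [add_zero]
      exact monic_X.mul h1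
    · exact Or.inr h1.p
  · ext i j
    fin_cases i <;> fin_cases j <;> simp [Matrix.mul_apply, Fin.sum_univ_two] <;> ring

open Polynomial in
lemma GoodMat.q {q : ℂ} (hq : q ≠ 0) {ne : Prop} {M : Matrix (Fin 2) (Fin 2) ℂ}
    (h : GoodMat q ne M) :
    GoodMat q True (!![1, 0; q⁻¹, -q⁻¹] * M) := by
  obtain ⟨c, x1, y1, x2, y2, hc, h1, h2, -, rfl⟩ := h
  have h1' : ColOK (X * x1) (x1 + y1) := by
    rcases h1 with ⟨h1, rfl⟩ | h1
    · rw [add_zero]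
      exact ⟨monic_X.mul h1, h1, deg_lt_X h1⟩
    · exact h1.q
  refine ⟨-c * q⁻¹, X * x1, x1 + y1, X * x2, x2 + y2, by simp [hc, hq], Or.inr h1', ?_,
    fun _ => Or.inl h1', ?_⟩
  · rcases h2 with ⟨rfl, rfl⟩ | h2
    · left
      simp
    · exact Or.inr h2.q
  · ext i j
    fin_cases i <;> fin_cases j <;> simp [Matrix.mul_apply, Fin.sum_univ_two] <;> field_simp <;> ring

lemma int_of_monic {q : ℂ} {p : Polynomial ℤ} (hp : p.Monic) (h : Polynomial.aeval (-q) p = 0) :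
    IsIntegral ℤ q := by
  have : IsIntegral ℤ (-q) := ⟨p, hp, h⟩
  simpa using this.neg

lemma GoodMat.int00 {q : ℂ} {ne : Prop} {M : Matrix (Fin 2) (Fin 2) ℂ} (h : GoodMat q ne M)
    (h0 : M 0 0 = 0) : IsIntegral ℤ q := by
  obtain ⟨c, x1, y1, x2, y2, hc, h1, h2, -, rfl⟩ := h
  have hx : x1.Monic := by rcases h1 with h1 | h1 <;> exact h1.1
  exact int_of_monic hx (by simpa [hc] using h0)

lemma GoodMat.int11 {q : ℂ} {ne : Prop} {M : Matrix (Fin 2) (Fin 2) ℂ} (h : GoodMat q ne M)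
    (h0 : M 1 1 = 0) : IsIntegral ℤ q := by
  obtain ⟨c, x1, y1, x2, y2, hc, h1, h2, -, rfl⟩ := h
  have hx : y2.Monic := by
    rcases h2 with h2 | h2
    · rw [h2.2]
      exact Polynomial.monic_one
    · exact h2.2.1
  exact int_of_monic hx (by simpa [hc] using h0)

lemma GoodMat.intOff {q : ℂ} {M : Matrix (Fin 2) (Fin 2) ℂ} (h : GoodMat q True M)
    (h0 : M 0 1 = 0) (h1' : M 1 0 = 0) : IsIntegral ℤ q := by
  obtain ⟨c, x1, y1, x2, y2, hc, h1, h2, h3, rfl⟩ := h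
  rcases h3 trivial with h | h
  · exact int_of_monic h.2.1 (by simpa [hc] using h1')
  · exact int_of_monic h.1 (by simpa [hc] using h0)

/-- Positive words in `s` and `r⁻¹`. -/
inductive PosWord {G : Type*} [Group G] (s r : G) : G → Prop
  | one : PosWord s r 1
  | p (w : G) : PosWord s r w → PosWord s r (s * w)
  | q (w : G) : PosWord s r w → PosWord s r (r⁻¹ * w)

/-- Normal form. -/
def NForm {G : Type*} [Group G] (s r : G) (g : G) : Prop :=
  ∃ (k : ℤ) (e w f : G), (e = 1 ∨ e = s * r * s) ∧ PosWord s r w ∧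
    (f = 1 ∨ f = s * r ∨ f = s * r * (s * r)) ∧
    g = ((s * r * s) * (s * r * s)) ^ k * (e * w * f)

section
variable {G : Type*} [Group G] {s r : G}

lemma nf_z (hb : s * r * s = r * s * r) (m : ℤ) {g : G} (h : NForm s r g) :
    NForm s r (((s * r * s) * (s * r * s)) ^ m * g) := by
  obtain ⟨k, e, w, f, he, hw, hf, rfl⟩ := h
  exact ⟨m + k, e, w, f, he, hw, hf, by
    rw [zpow_add, mul_assoc (_ ^ m)]⟩

lemma nf_D (hb : s * r * s = r * s * r) {g : G} (h : NForm s r g) :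
    NForm s r ((s * r * s) * g) := by
  obtain ⟨k, e, w, f, he, hw, hf, rfl⟩ := h
  have hc : Commute (s * r * s) (((s * r * s) * (s * r * s)) ^ k) :=
    Commute.zpow_right ((Commute.refl _).mul_right (Commute.refl _)) k
  rcases he with rfl | rfl
  · exact ⟨k, s * r * s, w, f, Or.inr rfl, hw, hf, by
      rw [← mul_assoc, hc.eq, mul_assoc, one_mul, mul_assoc (s * r * s) w f]⟩
  · refine ⟨k + 1, 1, w, f, Or.inl rfl, hw, hf, ?_⟩
    rw [← mul_assoc, hc.eq, zpow_add, zpow_one]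
    group

lemma z_eq (hb : s * r * s = r * s * r) :
    (s * r * s) * (s * r * s) = (s * r) * (s * r) * (s * r) := by
  nth_rewrite 2 [hb]
  group

lemma aD (hb : s * r * s = r * s * r) :
    s * r * (s * r * s) = ((s * r * s) * (s * r * s)) * r⁻¹ := by
  nth_rewrite 3 [hb]
  group

lemma ar (hb : s * r * s = r * s * r) : (s * r) * r⁻¹ = s := by group

lemma nf_a (hb : s * r * s = r * s * r) {g : G} (h : NForm s r g) :
    NForm s r ((s * r) * g) := by
  obtain ⟨k, e, w, f, he, hw, hf, rfl⟩ := h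
  have hc : Commute (s * r) (((s * r * s) * (s * r * s)) ^ k) := by
    rw [z_eq hb]
    exact Commute.zpow_right (((Commute.refl _).mul_right (Commute.refl _)).mul_right
      (Commute.refl _)) k
  rw [← mul_assoc, hc.eq, mul_assoc]
  apply nf_z hb
  rcases he with rfl | rfl
  · rw [one_mul]
    cases hw with
    | one =>
      rcases hf with rfl | rfl | rfl
      · exact ⟨0, 1, 1, s * r, Or.inl rfl, .one, Or.inr (Or.inl rfl), by simp⟩
      · exact ⟨0, 1, 1, _, Or.inl rfl, .one, Or.inr (Or.inr rfl), by simp⟩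
      · exact ⟨1, 1, 1, 1, Or.inl rfl, .one, Or.inl rfl, by
          rw [zpow_one, z_eq hb]
          group⟩
    | p w hw => exact ⟨0, s * r * s, w, f, Or.inr rfl, hw, hf, by group⟩
    | q w hw => exact ⟨0, 1, s * w, f, Or.inl rfl, .p w hw, hf, by group⟩
  · refine ⟨1, 1, r⁻¹ * w, f, Or.inl rfl, .q w hw, hf, ?_⟩
    rw [zpow_one, one_mul, ← mul_assoc, ← mul_assoc, aD hb]
    group

lemma nf_ainv (hb : s * r * s = r * s * r) {g : G} (h : NForm s r g) :
    NForm s r ((s * r)⁻¹ * g) := by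
  have := nf_z hb (-1) (nf_a hb (nf_a hb h))
  convert this using 1
  rw [zpow_neg_one, z_eq hb]
  group

lemma nf_Dinv (hb : s * r * s = r * s * r) {g : G} (h : NForm s r g) :
    NForm s r ((s * r * s)⁻¹ * g) := by
  have := nf_z hb (-1) (nf_D hb h)
  convert this using 1
  group

lemma nf_s (hb : s * r * s = r * s * r) {g : G} (h : NForm s r g) : NForm s r (s * g) := by
  convert nf_ainv hb (nf_D hb h) using 1
  group

lemma nf_sinv (hb : s * r * s = r * s * r) {g : G} (h : NForm s r g) : NForm s r (s⁻¹ * g) := by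
  convert nf_Dinv hb (nf_a hb h) using 1
  group

lemma nf_r (hb : s * r * s = r * s * r) {g : G} (h : NForm s r g) : NForm s r (r * g) := by
  convert nf_sinv hb (nf_a hb h) using 1
  group

lemma nf_rinv (hb : s * r * s = r * s * r) {g : G} (h : NForm s r g) : NForm s r (r⁻¹ * g) := by
  convert nf_ainv hb (nf_s hb h) using 1
  group
end

lemma braid_rel : σ₃ 0 * σ₃ 1 * σ₃ 0 = σ₃ 1 * σ₃ 0 * σ₃ 1 := by
  have : (PresentedGroup.mk braidRels3) (FreeGroup.of 0 * FreeGroup.of 1 * FreeGroup.of 0 *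
    (FreeGroup.of 1 * FreeGroup.of 0 * FreeGroup.of 1)⁻¹) = 1 :=
    PresentedGroup.one_of_mem (rels := braidRels3) rfl
  rw [map_mul, map_inv, mul_inv_eq_one] at this
  simp only [map_mul] at this
  exact this

lemma nf_all (g : BraidGroup3) : NForm (σ₃ 0) (σ₃ 1) g := by
  have key : ∀ x : FreeGroup (Fin 2), ∀ g, NForm (σ₃ 0) (σ₃ 1) g →
      NForm (σ₃ 0) (σ₃ 1) (PresentedGroup.mk braidRels3 x * g) := by
    intro x
    induction x using FreeGroup.induction_on with
    | C1 => intro g h; simpa using h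
    | of i =>
      intro g h
      fin_cases i
      · exact nf_s braid_rel h
      · exact nf_r braid_rel h
    | inv_of i _ =>
      intro g h
      rw [map_inv]
      fin_cases i
      · exact nf_sinv braid_rel h
      · exact nf_rinv braid_rel h
    | mul x y hx hy =>
      intro g h
      rw [map_mul, mul_assoc]
      exact hx _ (hy _ h)
  obtain ⟨x, rfl⟩ := PresentedGroup.mk_surjective braidRels3 g
  have := key x 1 ⟨0, 1, 1, 1, Or.inl rfl, .one, Or.inl rfl, by simp⟩
  simpa using this

lemma core (q0 : ℂ) (h0 : q0 ≠ 0)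
    (ρ : BraidGroup3 →* Matrix.GeneralLinearGroup (Fin 2) ℂ)
    (h1 : (ρ (σ₃ 0) : Matrix (Fin 2) (Fin 2) ℂ) = !![-q0, q0; 0, 1])
    (h2 : (ρ (σ₃ 1) : Matrix (Fin 2) (Fin 2) ℂ) = !![1, 0; 1, -q0])
    (g : BraidGroup3) (hg : ρ g = 1) (hne : g ≠ 1) : IsIntegral ℤ q0 := by
  have h2i : (ρ (σ₃ 1)⁻¹ : Matrix (Fin 2) (Fin 2) ℂ) = !![1, 0; q0⁻¹, -q0⁻¹] := by
    rw [map_inv, Matrix.coe_units_inv, h2]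
    apply Matrix.inv_eq_right_inv
    ext i j
    fin_cases i <;> fin_cases j <;> simp [Matrix.mul_apply, Fin.sum_univ_two, h0]
  have hword' : ∀ w, PosWord (σ₃ 0) (σ₃ 1) w → ∃ ne,
      GoodMat q0 ne (ρ w : Matrix (Fin 2) (Fin 2) ℂ) := by
    intro w hw
    induction hw with
    | one => exact ⟨False, by simpa using goodMat_one q0⟩
    | p w hw ih =>
      obtain ⟨ne, ih⟩ := ih
      refine ⟨True, ?_⟩
      rw [map_mul, Units.val_mul, h1]
      exact ih.p
    | q w hw ih =>
      obtain ⟨ne, ih⟩ := ih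
      refine ⟨True, ?_⟩
      rw [map_mul, Units.val_mul, h2i]
      exact ih.q h0
  have hs : ∀ w, PosWord (σ₃ 0) (σ₃ 1) w →
      GoodMat q0 True (ρ (σ₃ 0 * w) : Matrix (Fin 2) (Fin 2) ℂ) := by
    intro w hw
    obtain ⟨ne, h⟩ := hword' w hw
    rw [map_mul, Units.val_mul, h1]
    exact h.p
  have hr : ∀ w, PosWord (σ₃ 0) (σ₃ 1) w →
      GoodMat q0 True (ρ ((σ₃ 1)⁻¹ * w) : Matrix (Fin 2) (Fin 2) ℂ) := by
    intro w hw
    obtain ⟨ne, h⟩ := hword' w hw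
    rw [map_mul, Units.val_mul, h2i]
    exact h.q h0
  set s := σ₃ 0 with hsdef
  set r := σ₃ 1 with hrdef
  have hD : (ρ (s * r * s) : Matrix (Fin 2) (Fin 2) ℂ) = !![0, -q0 ^ 2; -q0, 0] := by
    rw [map_mul, map_mul, Units.val_mul, Units.val_mul, h1, h2]
    ext i j
    fin_cases i <;> fin_cases j <;> simp [Matrix.mul_apply, Fin.sum_univ_two] <;> ring
  have ha : (ρ (s * r) : Matrix (Fin 2) (Fin 2) ℂ) = !![0, -q0 ^ 2; 1, -q0] := by
    rw [map_mul, Units.val_mul, h1, h2]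
    ext i j
    fin_cases i <;> fin_cases j <;> simp [Matrix.mul_apply, Fin.sum_univ_two] <;> ring
  have hz : (ρ ((s * r * s) * (s * r * s)) : Matrix (Fin 2) (Fin 2) ℂ) =
      Matrix.scalar (Fin 2) (q0 ^ 3) := by
    rw [map_mul, Units.val_mul, hD]
    ext i j
    fin_cases i <;> fin_cases j <;> simp [Matrix.mul_apply, Fin.sum_univ_two] <;> ring
  -- scalar unit
  let u : ℂˣ := Units.mk0 q0 h0
  have hz' : ρ ((s * r * s) * (s * r * s)) = Units.map (Matrix.scalar (Fin 2)).toMonoidHom (u ^ 3) := by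
    ext1
    rw [hz]
    rfl
  have hzk : ∀ k : ℤ, (ρ (((s * r * s) * (s * r * s)) ^ k) : Matrix (Fin 2) (Fin 2) ℂ) =
      Matrix.scalar (Fin 2) (((u ^ 3) ^ k : ℂˣ) : ℂ) := by
    intro k
    rw [map_zpow, hz', ← map_zpow]
    rfl
  have hdiag : ∀ (x : BraidGroup3) (k : ℤ), ρ (((s * r * s) * (s * r * s)) ^ k * x) = 1 →
      ∃ c : ℂ, (ρ x : Matrix (Fin 2) (Fin 2) ℂ) = !![c, 0; 0, c] := by
    intro x k h
    have hx : ρ x = ρ (((s * r * s) * (s * r * s)) ^ (-k)) := by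
      rw [map_mul] at h
      rw [zpow_neg, map_inv]
      exact (inv_eq_of_mul_eq_one_right h).symm
    refine ⟨(((u ^ 3) ^ (-k) : ℂˣ) : ℂ), ?_⟩
    rw [hx, hzk]
    ext i j
    fin_cases i <;> fin_cases j <;> simp
  obtain ⟨k, e, w, f, he, hw, hf, hgk⟩ := nf_all g
  rw [← hsdef, ← hrdef] at *
  rw [hgk] at hg
  obtain ⟨c, hc⟩ := hdiag _ _ hg
  obtain ⟨ne, hW⟩ := hword' w hw
  have hoff : ∀ (x : BraidGroup3), GoodMat q0 True (ρ x : Matrix (Fin 2) (Fin 2) ℂ) →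
      ∀ c : ℂ, (ρ x : Matrix (Fin 2) (Fin 2) ℂ) = !![c, 0; 0, c] → IsIntegral ℤ q0 := by
    intro x hx c h
    exact hx.intOff (by simp [h]) (by simp [h])
  -- if `e w f` is scalar, so is `f e w`
  have hcyc : (ρ (f * e * w) : Matrix (Fin 2) (Fin 2) ℂ) = !![c, 0; 0, c] := by
    have hcs : !![c, 0; 0, c] = Matrix.scalar (Fin 2) c := by
      ext i j
      fin_cases i <;> fin_cases j <;> simp
    have : f * e * w = f * (e * w * f) * f⁻¹ := by group
    rw [this, map_mul, map_mul, Units.val_mul, Units.val_mul, hc, hcs,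
      ← (Matrix.scalar_commute c (fun _ => mul_comm _ _) _).eq, mul_assoc, ← Units.val_mul,
      ← map_mul]
    simp
  rcases he with rfl | rfl
  · rcases hf with rfl | rfl | rfl
    · cases hw with
      | one =>
        simp only [mul_one] at hg hgk
        have hk : k ≠ 0 := by
          rintro rfl
          simp at hgk
          exact hne hgk
        have h3 := hzk k
        rw [hg] at h3
        have h4 := congrFun (congrFun h3 0) 0
        simp only [Units.val_one, Matrix.one_apply_eq, Matrix.scalar_apply,
          Matrix.diagonal_apply_eq] at h4
        have h5 : u ^ (3 * k) = 1 := by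
          ext1
          rw [zpow_mul]
          exact h4.symm
        have h6 : u ^ ((3 * k).natAbs) = 1 := by
          rcases Int.natAbs_eq (3 * k) with h | h
          · rw [← zpow_natCast, ← h, h5]
          · rw [← zpow_natCast, ← inv_inj, ← zpow_neg, ← h, h5, inv_one]
        have h7 : q0 ^ ((3 * k).natAbs) = 1 := by
          have := congrArg (fun v : ℂˣ => (v : ℂ)) h6
          simpa [u] using this
        refine IsIntegral.of_pow (n := (3 * k).natAbs) (by omega) ?_
        rw [h7]
        exact isIntegral_one
      | p w hw => exact hoff _ (hs w hw) c (by simpa using hc)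
      | q w hw => exact hoff _ (hr w hw) c (by simpa using hc)
    · -- a w scalar
      rw [mul_one, map_mul, Units.val_mul, ha] at hcyc
      have := congrFun (congrFun hcyc 0) 1
      simp [Matrix.mul_apply, Fin.sum_univ_two, h0] at this
      exact hW.int11 this
    · rw [mul_one, map_mul, Units.val_mul, map_mul, Units.val_mul, ha] at hcyc
      have := congrFun (congrFun hcyc 1) 0
      have hz0 : -q0 ^ 2 + q0 * q0 = 0 := by ring
      simp [Matrix.mul_apply, Fin.sum_univ_two, hz0, h0] at this
      exact hW.int00 this
  · rcases hf with rfl | rfl | rfl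
    · rw [one_mul, map_mul, Units.val_mul, hD] at hcyc
      have := congrFun (congrFun hcyc 1) 0
      simp [Matrix.mul_apply, Fin.sum_univ_two, h0] at this
      exact hW.int00 this
    · have h := hcyc
      have hx := hr w hw
      have e1 : s * r * (s * r * s) * w = ((s * r * s) * (s * r * s)) * (r⁻¹ * w) := by
        rw [aD braid_rel, mul_assoc]
      rw [e1, map_mul, Units.val_mul, hz] at h
      have a1 := congrFun (congrFun h 0) 1
      have a2 := congrFun (congrFun h 1) 0
      simp only [Matrix.scalar_apply, Matrix.diagonal_mul] at a1 a2
      refine hx.intOff ?_ ?_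
      · simpa [h0] using a1
      · simpa [h0] using a2
    · have h := hcyc
      have hx := hs w hw
      have e1 : s * r * (s * r) * (s * r * s) * w =
          ((s * r * s) * (s * r * s)) * (s * w) := by
        rw [z_eq (s := s) (r := r) braid_rel]
        group
      rw [e1, map_mul, Units.val_mul, hz] at h
      have a1 := congrFun (congrFun h 0) 1
      have a2 := congrFun (congrFun h 1) 0
      simp only [Matrix.scalar_apply, Matrix.diagonal_mul] at a1 a2
      refine hx.intOff ?_ ?_
      · simpa [h0] using a1
      · simpa [h0] using a2

/-- The automorphism `σᵢ ↦ σᵢ⁻¹`. -/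
def invAut : BraidGroup3 →* BraidGroup3 :=
  PresentedGroup.toGroup (rels := braidRels3) (f := fun i => (σ₃ i)⁻¹) (by
    intro x hx
    rw [braidRels3, Set.mem_singleton_iff] at hx
    subst hx
    have h := congrArg (fun g => g⁻¹) braid_rel
    simp only [mul_inv_rev] at h
    simp only [map_mul, map_inv, FreeGroup.lift_apply_of, mul_inv_eq_one]
    simpa [mul_assoc] using h)

lemma invAut_of (i : Fin 2) : invAut (σ₃ i) = (σ₃ i)⁻¹ := PresentedGroup.toGroup.of _

lemma invAut_invAut (g : BraidGroup3) : invAut (invAut g) = g := by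
  have : invAut.comp invAut = MonoidHom.id _ := by
    apply PresentedGroup.ext
    intro i
    change invAut (invAut (σ₃ i)) = σ₃ i
    rw [invAut_of, map_inv, invAut_of, inv_inv]
  exact DFunLike.congr_fun this g

/-- if the reduced Burau representation of `B₃` specialized at a nonzero
complex number `q0` is not injective, then both `q0` and `1/q0` are roots of a monic
polynomial with integer coefficients; in particular both are algebraic integers. -/
theorem burau_B3_unfaithful_implies_algebraic_integer
    (q0 : ℂ) (h0 : q0 ≠ 0)
    (ρ : BraidGroup3 →* Matrix.GeneralLinearGroup (Fin 2) ℂ)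
    (h1 : (ρ (σ₃ 0) : Matrix (Fin 2) (Fin 2) ℂ) = !![-q0, q0; 0, 1])
    (h2 : (ρ (σ₃ 1) : Matrix (Fin 2) (Fin 2) ℂ) = !![1, 0; 1, -q0])
    (hker : ¬ Function.Injective ρ) :
    (∃ p : Polynomial ℤ, p.Monic ∧
        Polynomial.aeval q0 p = 0 ∧ Polynomial.aeval q0⁻¹ p = 0) ∧
      IsIntegral ℤ q0 ∧ IsIntegral ℤ q0⁻¹ := by

  have hk : ∃ g, ρ g = 1 ∧ g ≠ 1 := by
    rw [injective_iff_map_eq_one] at hker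
    push Not at hker
    exact hker
  obtain ⟨g, hg, hne⟩ := hk
  have i1 : IsIntegral ℤ q0 := core q0 h0 ρ h1 h2 g hg hne
  have i2 : IsIntegral ℤ q0⁻¹ := by
    let D : Matrix.GeneralLinearGroup (Fin 2) ℂ :=
      ⟨!![1, 0; 0, q0], !![1, 0; 0, q0⁻¹], by
        ext i j
        fin_cases i <;> fin_cases j <;> simp [h0], by
        ext i j
        fin_cases i <;> fin_cases j <;> simp [h0]⟩
    let ρ' : BraidGroup3 →* Matrix.GeneralLinearGroup (Fin 2) ℂ :=
      (MulAut.conj D).toMonoidHom.comp (ρ.comp invAut)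
    have hρ' : ∀ x, ρ' x = D * ρ (invAut x) * D⁻¹ := fun x => rfl
    have hDi : ((D⁻¹ : Matrix.GeneralLinearGroup (Fin 2) ℂ) : Matrix (Fin 2) (Fin 2) ℂ) =
      !![1, 0; 0, q0⁻¹] := rfl
    have hDv : (D : Matrix (Fin 2) (Fin 2) ℂ) = !![1, 0; 0, q0] := rfl
    have e1 : (ρ (σ₃ 0)⁻¹ : Matrix (Fin 2) (Fin 2) ℂ) = !![-q0⁻¹, 1; 0, 1] := by
      rw [map_inv, Matrix.coe_units_inv, h1]
      apply Matrix.inv_eq_right_inv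
      ext i j
      fin_cases i <;> fin_cases j <;> simp [Matrix.mul_apply, Fin.sum_univ_two, h0]
    have e2 : (ρ (σ₃ 1)⁻¹ : Matrix (Fin 2) (Fin 2) ℂ) = !![1, 0; q0⁻¹, -q0⁻¹] := by
      rw [map_inv, Matrix.coe_units_inv, h2]
      apply Matrix.inv_eq_right_inv
      ext i j
      fin_cases i <;> fin_cases j <;> simp [Matrix.mul_apply, Fin.sum_univ_two, h0]
    refine core q0⁻¹ (inv_ne_zero h0) ρ' ?_ ?_ (invAut g) ?_ ?_
    · rw [hρ', invAut_of, Units.val_mul, Units.val_mul, hDi, hDv, e1]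
      ext i j
      fin_cases i <;> fin_cases j <;> simp [Matrix.mul_apply, Fin.sum_univ_two, h0]
    · rw [hρ', invAut_of, Units.val_mul, Units.val_mul, hDi, hDv, e2]
      ext i j
      fin_cases i <;> fin_cases j <;> simp [Matrix.mul_apply, Fin.sum_univ_two, h0]
    · rw [hρ', invAut_invAut, hg]
      simp
    · intro h
      apply hne
      rw [← invAut_invAut g, h, map_one]
  refine ⟨?_, i1, i2⟩
  obtain ⟨p, hp, hp0⟩ := i1
  obtain ⟨r, hr, hr0⟩ := i2
  refine ⟨p * r, hp.mul hr, ?_, ?_⟩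
  · rw [map_mul, Polynomial.aeval_def, hp0, zero_mul]
  · rw [map_mul, Polynomial.aeval_def q0⁻¹ r, hr0, mul_zero]
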